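/- Let N > 2s and q ∈ (1, 2*_s), where 2*_s = 2N/(N−2s). There exists a constant C > 0 depending only on N, s and q with the following property: for every open set Ω ⊆ ℝ^N for which the embedding 𝒦(Ω) ↪ L^q(Ω) is compact, every λ > 0 and every q-semilinear s-eigenfunction u of Ω with eigenvalue λ, one has u ∈ L^∞(Ω) and ‖u‖_{L^∞(Ω)} ≤ C · λ^{2*_s/(2(2*_s − q))} · ‖u‖_{L^q(Ω)}. -/

import Mathlib

open MeasureTheory Filter Topology
open scoped ENNReal RealInnerProductSpace

noncomputable section

abbrev Euc (N : ℕ) := EuclideanSpace ℝ (Fin N)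

/-- Gagliardo energy `[u]_s²`. -/
def gagliardo (N : ℕ) (s : ℝ) (u : Euc N → ℝ) : ℝ≥0∞ :=
  ∫⁻ x : Euc N, ∫⁻ y : Euc N, ENNReal.ofReal ((u x - u y) ^ 2 / ‖x - y‖ ^ ((N : ℝ) + 2 * s))

/-- membership in the concrete model of `𝒟^{s,2}_0(Ω)`. -/
def memK (N : ℕ) (s : ℝ) (Ω : Set (Euc N)) (u : Euc N → ℝ) : Prop :=
  Measurable u ∧ (∀ᵐ x : Euc N ∂volume, x ∉ Ω → u x = 0) ∧ gagliardo N s u < ⊤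

/-- first `q`-semilinear `s`-eigenvalue. -/
def lambda1 (N : ℕ) (s q : ℝ) (Ω : Set (Euc N)) : ℝ≥0∞ :=
  ⨅ u ∈ {u : Euc N → ℝ | memK N s Ω u ∧ (∫ x in Ω, |u x| ^ q) = 1}, gagliardo N s u

/-- nonlocal bilinear form. -/
def dform (N : ℕ) (s : ℝ) (u φ : Euc N → ℝ) : ℝ :=
  ∫ p : Euc N × Euc N, (u p.1 - u p.2) * (φ p.1 - φ p.2) / ‖p.1 - p.2‖ ^ ((N : ℝ) + 2 * s)

/-- compactness of the embedding `𝒦(Ω) ↪ L^q(Ω)`. -/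
def compactEmbed (N : ℕ) (s q : ℝ) (Ω : Set (Euc N)) : Prop :=
  ∀ u : ℕ → Euc N → ℝ, (∀ n, memK N s Ω (u n)) →
    (∃ C : ℝ≥0∞, C < ⊤ ∧ ∀ n, gagliardo N s (u n) ≤ C) →
    ∃ (σ : ℕ → ℕ) (v : Euc N → ℝ), StrictMono σ ∧
      Tendsto (fun k => ∫ x in Ω, |u (σ k) x - v x| ^ q) atTop (𝓝 0)

/-- `q`-semilinear `s`-eigenfunction with eigenvalue `lam`. -/
def isEigenfunction (N : ℕ) (s q : ℝ) (Ω : Set (Euc N)) (lam : ℝ) (u : Euc N → ℝ) : Prop :=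
  memK N s Ω u ∧ 0 < ∫ x in Ω, |u x| ^ q ∧
  ∀ φ : Euc N → ℝ, memK N s Ω φ →
    dform N s u φ
      = lam * (∫ x in Ω, |u x| ^ q) ^ ((2 - q) / q) * ∫ x in Ω, |u x| ^ (q - 2) * u x * φ x

/-- `q`-semilinear `s`-eigenvalue. -/
def isEigenvalue (N : ℕ) (s q : ℝ) (Ω : Set (Euc N)) (lam : ℝ) : Prop :=
  0 < lam ∧ ∃ u : Euc N → ℝ, isEigenfunction N s q Ω lam u

/-- free energy functional `J_Ω`. -/
def freeEnergy (N : ℕ) (s q : ℝ) (Ω : Set (Euc N)) (φ : Euc N → ℝ) : ℝ :=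
  (1 / 2) * (gagliardo N s φ).toReal - (1 / q) * ∫ x in Ω, φ x ^ q

/-- Lane–Emden density of `Ω`: minimizer of the free energy among nonnegative members of `𝒦(Ω)`. -/
def isLaneEmden (N : ℕ) (s q : ℝ) (Ω : Set (Euc N)) (w : Euc N → ℝ) : Prop :=
  memK N s Ω w ∧ (∀ᵐ x : Euc N ∂volume, 0 ≤ w x) ∧
  ∀ φ : Euc N → ℝ, memK N s Ω φ → (∀ᵐ x : Euc N ∂volume, 0 ≤ φ x) →
    freeEnergy N s q Ω w ≤ freeEnergy N s q Ω φ

/-- weak solution of the fractional Lane–Emden equation in `Ω`. -/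
def isWeakSolutionLE (N : ℕ) (s q : ℝ) (Ω : Set (Euc N)) (u : Euc N → ℝ) : Prop :=
  memK N s Ω u ∧ ∀ φ : Euc N → ℝ, memK N s Ω φ →
    dform N s u φ = ∫ x in Ω, |u x| ^ (q - 2) * u x * φ x

/-- nonlocal tail. -/
def nlTail (N : ℕ) (s : ℝ) (w : Euc N → ℝ) (x₀ : Euc N) (ρ : ℝ) : ℝ :=
  ρ ^ (2 * s) * ∫ x in (Metric.ball x₀ ρ)ᶜ, |w x| / ‖x - x₀‖ ^ ((N : ℝ) + 2 * s)

lemma superlevel_setLIntegral_step {α : Type*} [MeasurableSpace α] {μ : Measure α} {v : α → ℝ}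
    (hv : Measurable v) {q σ : ℝ} (hq : 1 < q) (hσ : 0 < σ) {A : ℝ≥0∞}
    (H : ∀ k h : ℝ, 1 ≤ k → k < h → ENNReal.ofReal (h - k) * μ {x | h < v x} ≤
      A * μ {x | k < v x} ^ σ * ∫⁻ x in {x | k < v x}, ENNReal.ofReal (v x) ^ (q - 1) ∂μ)
    {k h : ℝ} (hk : 1 ≤ k) (hkh : k < h) (hh : h ≤ 2) :
    ENNReal.ofReal (h - k) * ∫⁻ x in {x | h < v x}, ENNReal.ofReal (v x) ^ q ∂μ ≤
      4 ^ q * A * (1 - 2 ^ (-(2 - q + q * σ)))⁻¹ *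
        (∫⁻ x in {x | k < v x}, ENNReal.ofReal (v x) ^ q ∂μ) ^ (1 + σ) := by
  set F := ∫⁻ x in {x | k < v x}, ENNReal.ofReal (v x) ^ q ∂μ with hF
  have hcover : {x | h < v x} ⊆ ⋃ j : ℕ, {x | 2 ^ j * h < v x ∧ v x ≤ 2 ^ (j + 1) * h} := by
    intro x hx
    simp only [Set.mem_ofPred_eq] at hx
    have hh0 : 0 < h := by linarith
    have hex : ∃ n : ℕ, v x ≤ 2 ^ n * h := by
      obtain ⟨n, hn⟩ := pow_unbounded_of_one_lt (v x / h) (one_lt_two)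
      exact ⟨n, ((div_lt_iff₀ hh0).1 hn).le⟩
    classical
    have h0 : Nat.find hex ≠ 0 := by
      intro h0
      have := Nat.find_spec hex
      rw [h0] at this
      simp at this
      linarith
    obtain ⟨j, hj⟩ := Nat.exists_eq_succ_of_ne_zero h0
    refine Set.mem_iUnion.2 ⟨j, ?_, ?_⟩
    · have := Nat.find_min hex (m := j) (by omega)
      exact not_le.1 this
    · have := Nat.find_spec hex
      rw [hj] at this
      exact this
  have hlayer : ∀ j : ℕ, ENNReal.ofReal (h - k) *
      ∫⁻ x in {x | 2 ^ j * h < v x ∧ v x ≤ 2 ^ (j + 1) * h}, ENNReal.ofReal (v x) ^ q ∂μ ≤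
      4 ^ q * A * F ^ (1 + σ) * (2 ^ (-(2 - q + q * σ))) ^ j := by
    intro j
    set t : ℝ≥0∞ := 2 ^ j with ht
    have ht0 : t ≠ 0 := by simp [ht]
    have htt : t ≠ ⊤ := by simp [ht]
    have htR : ENNReal.ofReal ((2 : ℝ) ^ j) = t := by
      rw [ENNReal.ofReal_pow (by norm_num)]; simp [ht]
    have h2j : (1 : ℝ) ≤ 2 ^ j := one_le_pow₀ one_le_two
    have hsub : {x | 2 ^ j * k < v x} ⊆ {x | k < v x} := by
      intro x hx
      simp only [Set.mem_ofPred_eq] at hx ⊢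
      nlinarith
    have htv : ∀ x ∈ {x | 2 ^ j * k < v x}, t ≤ ENNReal.ofReal (v x) := by
      intro x hx
      rw [← htR]
      simp only [Set.mem_ofPred_eq] at hx
      exact ENNReal.ofReal_le_ofReal (by nlinarith)
    have ha : ∫⁻ x in {x | 2 ^ j * h < v x ∧ v x ≤ 2 ^ (j + 1) * h}, ENNReal.ofReal (v x) ^ q ∂μ ≤
        4 ^ q * t ^ q * μ {x | 2 ^ j * h < v x} := by
      calc _ ≤ ∫⁻ x in {x | 2 ^ j * h < v x ∧ v x ≤ 2 ^ (j + 1) * h}, (4 ^ q * t ^ q) ∂μ := by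
            refine setLIntegral_mono measurable_const fun x hx => ?_
            rw [← ENNReal.mul_rpow_of_nonneg _ _ (by linarith)]
            refine ENNReal.rpow_le_rpow ?_ (by linarith)
            calc ENNReal.ofReal (v x) ≤ ENNReal.ofReal (4 * 2 ^ j) := by
                  refine ENNReal.ofReal_le_ofReal (hx.2.trans ?_)
                  rw [pow_succ]; nlinarith
              _ = 4 * t := by rw [ENNReal.ofReal_mul (by norm_num), htR]; simp
        _ ≤ _ := by
            rw [setLIntegral_const]
            gcongr
            exact And.left
    have hb := H (2 ^ j * k) (2 ^ j * h) (by nlinarith) (by gcongr)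
    rw [← mul_sub, ENNReal.ofReal_mul (by positivity), htR] at hb
    have hc : t * ∫⁻ x in {x | 2 ^ j * k < v x}, ENNReal.ofReal (v x) ^ (q - 1) ∂μ ≤ F := by
      rw [← lintegral_const_mul _ (by fun_prop)]
      refine le_trans (setLIntegral_mono (by fun_prop) fun x hx => ?_)
        (lintegral_mono_set hsub)
      calc t * ENNReal.ofReal (v x) ^ (q - 1)
          ≤ ENNReal.ofReal (v x) ^ (1 : ℝ) * ENNReal.ofReal (v x) ^ (q - 1) := by
            rw [ENNReal.rpow_one]; gcongr; exact htv x hx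
        _ = _ := by
            rw [← ENNReal.rpow_add_of_nonneg _ _ (by norm_num) (by linarith)]; congr 1; ring
    have hd : t ^ q * μ {x | 2 ^ j * k < v x} ≤ F := by
      rw [← setLIntegral_const]
      refine le_trans (setLIntegral_mono (by fun_prop) fun x hx => ?_)
        (lintegral_mono_set hsub)
      exact ENNReal.rpow_le_rpow (htv x hx) (by linarith)
    have hd' : t ^ (q * σ) * μ {x | 2 ^ j * k < v x} ^ σ ≤ F ^ σ := by
      rw [ENNReal.rpow_mul, ← ENNReal.mul_rpow_of_nonneg _ _ hσ.le]
      exact ENNReal.rpow_le_rpow hd hσ.le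
    have hpow : (2 ^ (-(2 - q + q * σ)) : ℝ≥0∞) ^ j = t ^ (-(2 - q + q * σ)) := by
      rw [ht, ← ENNReal.rpow_natCast, ← ENNReal.rpow_natCast, ← ENNReal.rpow_mul,
        ← ENNReal.rpow_mul, mul_comm]
    have htq : t ^ q = t ^ (-(2 - q + q * σ)) * (t ^ (q * σ) * (t * t)) := by
      rw [show t * t = t ^ (2 : ℝ) by rw [ENNReal.rpow_two, sq], ← ENNReal.rpow_add _ _ ht0 htt,
        ← ENNReal.rpow_add _ _ ht0 htt]
      congr 1; ring
    rw [hpow]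
    calc _ ≤ ENNReal.ofReal (h - k) * (4 ^ q * t ^ q * μ {x | 2 ^ j * h < v x}) := by gcongr
      _ = 4 ^ q * t ^ (-(2 - q + q * σ)) * (t ^ (q * σ) * t) *
          (t * ENNReal.ofReal (h - k) * μ {x | 2 ^ j * h < v x}) := by
          rw [htq]; ring
      _ ≤ 4 ^ q * t ^ (-(2 - q + q * σ)) * (t ^ (q * σ) * t) *
          (A * μ {x | 2 ^ j * k < v x} ^ σ *
            ∫⁻ x in {x | 2 ^ j * k < v x}, ENNReal.ofReal (v x) ^ (q - 1) ∂μ) := by gcongr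
      _ = 4 ^ q * t ^ (-(2 - q + q * σ)) * A *
          ((t ^ (q * σ) * μ {x | 2 ^ j * k < v x} ^ σ) *
            (t * ∫⁻ x in {x | 2 ^ j * k < v x}, ENNReal.ofReal (v x) ^ (q - 1) ∂μ)) := by ring
      _ ≤ 4 ^ q * t ^ (-(2 - q + q * σ)) * A * (F ^ σ * F) := by gcongr
      _ = _ := by
          rw [ENNReal.rpow_add_of_nonneg _ _ zero_le_one hσ.le, ENNReal.rpow_one]; ring
  calc _ ≤ ENNReal.ofReal (h - k) *
        ∑' j : ℕ, ∫⁻ x in {x | 2 ^ j * h < v x ∧ v x ≤ 2 ^ (j + 1) * h},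
          ENNReal.ofReal (v x) ^ q ∂μ := by
        gcongr
        exact (lintegral_mono_set hcover).trans (lintegral_iUnion_le _ _)
    _ ≤ ∑' j : ℕ, 4 ^ q * A * F ^ (1 + σ) * (2 ^ (-(2 - q + q * σ))) ^ j := by
        rw [← ENNReal.tsum_mul_left]
        exact ENNReal.tsum_le_tsum hlayer
    _ = _ := by
        rw [ENNReal.tsum_mul_left, ENNReal.tsum_geometric]; ring

lemma ae_le_two_of_superlevel_decay {α : Type*} [MeasurableSpace α] {μ : Measure α} {v : α → ℝ}
    (hv : Measurable v) {q σ : ℝ} (hq : 1 < q) (hσ : 0 < σ) {A : ℝ≥0∞}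
    (H : ∀ k h : ℝ, 1 ≤ k → k < h → ENNReal.ofReal (h - k) * μ {x | h < v x} ≤
      A * μ {x | k < v x} ^ σ * ∫⁻ x in {x | k < v x}, ENNReal.ofReal (v x) ^ (q - 1) ∂μ)
    (hfin : ∫⁻ x, ENNReal.ofReal (v x) ^ q ∂μ ≠ ⊤)
    (hsmall : 2 * (4 ^ q * A * (1 - 2 ^ (-(2 - q + q * σ)))⁻¹) *
      (∫⁻ x, ENNReal.ofReal (v x) ^ q ∂μ) ^ σ ≤ 2 ^ (-(1 / σ))) :
    ∀ᵐ x ∂μ, v x ≤ 2 := by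
  set B : ℝ≥0∞ := 4 ^ q * A * (1 - 2 ^ (-(2 - q + q * σ)))⁻¹
  set G := ∫⁻ x, ENNReal.ofReal (v x) ^ q ∂μ
  set r : ℝ≥0∞ := 2 ^ (-(1 / σ)) with hr
  have hr1 : r < 1 := ENNReal.rpow_lt_one_of_one_lt_of_neg (by norm_num)
    (neg_lt_zero.2 (by positivity))
  have hrσ : r ^ σ = 2⁻¹ := by
    rw [hr, ← ENNReal.rpow_mul, show -(1 / σ) * σ = -1 by field_simp, ENNReal.rpow_neg_one]
  set F : ℝ → ℝ≥0∞ := fun k => ∫⁻ x in {x | k < v x}, ENNReal.ofReal (v x) ^ q ∂μ with hF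
  have hFG : ∀ k, F k ≤ G := fun k => setLIntegral_le_lintegral _ _
  have key : ∀ n : ℕ, F (2 - (1 / 2) ^ n) ≤ G * r ^ n := by
    intro n
    induction n with
    | zero => simpa using hFG _
    | succ n ih =>
      have hp : (0 : ℝ) < (1 / 2) ^ n := by positivity
      have hp1 : ((1 : ℝ) / 2) ^ n ≤ 1 := pow_le_one₀ (by norm_num) (by norm_num)
      have hstep := superlevel_setLIntegral_step hv hq hσ H (k := 2 - (1 / 2) ^ n)
        (h := 2 - (1 / 2) ^ (n + 1)) (by linarith) (by rw [pow_succ]; linarith)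
        (by rw [pow_succ]; linarith)
      have hdiff : ENNReal.ofReal (2 - (1 / 2) ^ (n + 1) - (2 - (1 / 2) ^ n)) = 2⁻¹ ^ (n + 1) := by
        rw [show (2 - (1 / 2) ^ (n + 1) - (2 - (1 / 2) ^ n) : ℝ) = (2⁻¹) ^ (n + 1) by
          rw [pow_succ]; ring_nf, ENNReal.ofReal_pow (by norm_num),
          ENNReal.ofReal_inv_of_pos (by norm_num)]
        simp
      rw [hdiff] at hstep
      have h2 : (2 : ℝ≥0∞) ^ n * 2⁻¹ ^ n = 1 := by
        rw [← mul_pow, ENNReal.mul_inv_cancel (by simp) (by simp), one_pow]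
      have hrn : (r ^ n) ^ σ = 2⁻¹ ^ n := by
        rw [← hrσ, ← ENNReal.rpow_natCast, ← ENNReal.rpow_natCast, ← ENNReal.rpow_mul r,
          ← ENNReal.rpow_mul r, mul_comm]
      calc F (2 - (1 / 2) ^ (n + 1))
          = 2 ^ (n + 1) * (2⁻¹ ^ (n + 1) * F (2 - (1 / 2) ^ (n + 1))) := by
            rw [← mul_assoc, ← mul_pow, ENNReal.mul_inv_cancel (by simp) (by simp), one_pow,
              one_mul]
        _ ≤ 2 ^ (n + 1) * (B * F (2 - (1 / 2) ^ n) ^ (1 + σ)) := by gcongr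
        _ ≤ 2 ^ (n + 1) * (B * (G * r ^ n) ^ (1 + σ)) := by gcongr
        _ = (2 * B * G ^ σ) * (G * r ^ n) * (2 ^ n * 2⁻¹ ^ n) := by
            rw [ENNReal.rpow_add_of_nonneg _ _ zero_le_one hσ.le, ENNReal.rpow_one,
              ENNReal.mul_rpow_of_nonneg _ _ hσ.le, hrn]
            ring
        _ ≤ r * (G * r ^ n) * (2 ^ n * 2⁻¹ ^ n) := by gcongr
        _ = G * r ^ (n + 1) := by rw [h2]; ring
  have hF2 : F 2 = 0 := by
    have hlim : Tendsto (fun n : ℕ => G * r ^ n) atTop (𝓝 0) := by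
      have := ENNReal.Tendsto.const_mul (a := G)
        (ENNReal.tendsto_pow_atTop_nhds_zero_of_lt_one hr1) (Or.inr hfin)
      simpa using this
    refine le_antisymm (ge_of_tendsto' hlim fun n => le_trans ?_ (key n)) zero_le
    refine lintegral_mono_set fun x hx => ?_
    have hp : (0 : ℝ) < (1 / 2) ^ n := by positivity
    simp only [Set.mem_ofPred_eq] at hx ⊢
    linarith
  rw [ae_iff]
  simp only [not_le]
  have h1 : μ {x | 2 < v x} ≤ F 2 := by
    rw [← setLIntegral_one]
    refine setLIntegral_mono (by fun_prop) fun x hx => ?_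
    refine ENNReal.one_le_rpow ?_ (by linarith)
    simp only [Set.mem_ofPred_eq] at hx
    rw [ENNReal.one_le_ofReal]; linarith
  rw [hF2] at h1
  exact le_antisymm h1 zero_le

lemma lintegral_sq_le_gagliardo {N : ℕ} (hN : 1 ≤ N) {s : ℝ} (hs : 0 < s) :
    ∃ D : ℝ, 0 < D ∧ ∀ φ : Euc N → ℝ, Measurable φ → volume {x | φ x ≠ 0} ≠ ⊤ →
      ∫⁻ x, ENNReal.ofReal (φ x ^ 2) ≤
        ENNReal.ofReal D * volume {x | φ x ≠ 0} ^ (2 * s / N) * gagliardo N s φ := by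
  have : Nonempty (Fin N) := ⟨⟨0, hN⟩⟩
  have hN0 : (0 : ℝ) < N := by exact_mod_cast hN
  set w : ℝ := (volume (Metric.ball (0 : Euc N) 1)).toReal with hw
  have hwtop : volume (Metric.ball (0 : Euc N) 1) ≠ ⊤ := measure_ball_lt_top.ne
  have hw0 : 0 < w := ENNReal.toReal_pos (Metric.measure_ball_pos _ _ one_pos).ne' hwtop
  refine ⟨(2 / w) * (2 / w) ^ (2 * s / N), by positivity, fun φ hφ hfin => ?_⟩
  set S := {x | φ x ≠ 0} with hS
  have hSm : MeasurableSet S := (hφ (measurableSet_singleton 0)).compl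
  set V : ℝ := (volume S).toReal with hV
  rcases eq_or_ne (volume S) 0 with h0 | h0
  · have : ∀ᵐ x : Euc N, ENNReal.ofReal (φ x ^ 2) = 0 := by
      have : ∀ᵐ x : Euc N, ¬ x ∈ S := measure_eq_zero_iff_ae_notMem.1 h0
      filter_upwards [this] with x hx
      have : φ x = 0 := by simpa [hS] using hx
      simp [this]
    rw [lintegral_congr_ae this]
    simp
  have hV0 : 0 < V := ENNReal.toReal_pos h0 hfin
  set R : ℝ := (2 * V / w) ^ (1 / (N : ℝ)) with hR
  have hR0 : 0 < R := by positivity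
  have hRN : R ^ N = 2 * V / w := by
    rw [hR, ← Real.rpow_natCast, ← Real.rpow_mul (by positivity)]
    simp [hN0.ne']
  have hball : ∀ x : Euc N, volume (Metric.ball x R) = ENNReal.ofReal (2 * V) := by
    intro x
    rw [Measure.addHaar_ball _ _ hR0.le, finrank_euclideanSpace, Fintype.card_fin, hRN,
      ← ENNReal.ofReal_toReal hwtop, ← hw, ← ENNReal.ofReal_mul (by positivity)]
    congr 1; field_simp
  have hRs : V / R ^ ((N : ℝ) + 2 * s) =
      ((2 / w) * (2 / w) ^ (2 * s / N) * V ^ (2 * s / N))⁻¹ := by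
    have h1 : R ^ (2 * s) = (2 / w) ^ (2 * s / N) * V ^ (2 * s / N) := by
      rw [hR, ← Real.rpow_mul (by positivity), ← Real.mul_rpow (by positivity) (by positivity)]
      congr 1 <;> ring
    rw [Real.rpow_add hR0, Real.rpow_natCast, hRN, h1]
    field_simp
  set c : ℝ := (2 / w) * (2 / w) ^ (2 * s / N) * V ^ (2 * s / N) with hc
  have hc0 : 0 < c := by positivity
  have hpt : ∀ x : Euc N, ENNReal.ofReal (φ x ^ 2) ≤ ENNReal.ofReal c *
      ∫⁻ y : Euc N, ENNReal.ofReal ((φ x - φ y) ^ 2 / ‖x - y‖ ^ ((N : ℝ) + 2 * s)) := by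
    intro x
    rcases eq_or_ne (φ x) 0 with hx | hx
    · simp [hx]
    have hvol : ENNReal.ofReal V ≤ volume (Metric.ball x R \ S) := by
      refine le_trans ?_ (le_measure_sdiff)
      rw [hball, ← ENNReal.ofReal_toReal hfin, ← hV, ← ENNReal.ofReal_sub _ hV0.le]
      exact ENNReal.ofReal_le_ofReal (by linarith)
    calc ENNReal.ofReal (φ x ^ 2)
        = ENNReal.ofReal c * (ENNReal.ofReal (φ x ^ 2 / R ^ ((N : ℝ) + 2 * s)) *
            ENNReal.ofReal V) := by
          rw [← ENNReal.ofReal_mul (by positivity), ← ENNReal.ofReal_mul hc0.le]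
          congr 1
          rw [div_mul_eq_mul_div, mul_div_assoc, hRs]
          field_simp
      _ ≤ ENNReal.ofReal c * (ENNReal.ofReal (φ x ^ 2 / R ^ ((N : ℝ) + 2 * s)) *
            volume (Metric.ball x R \ S)) := by gcongr
      _ ≤ _ := by
          gcongr
          rw [← setLIntegral_const]
          refine le_trans (setLIntegral_mono' (measurableSet_ball.diff hSm) fun y hy => ?_)
            (setLIntegral_le_lintegral _ _)
          have hy0 : φ y = 0 := by simpa [hS] using hy.2
          have hxy : x ≠ y := by rintro rfl; exact hx hy0
          have hn : 0 < ‖x - y‖ := norm_pos_iff.2 (sub_ne_zero.2 hxy)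
          have hle : ‖x - y‖ ≤ R := by
            have := Metric.mem_ball'.1 hy.1
            rw [dist_eq_norm] at this
            exact this.le
          rw [hy0, sub_zero]
          refine ENNReal.ofReal_le_ofReal ?_
          gcongr
  have hmain := lintegral_mono (μ := (volume : Measure (Euc N))) hpt
  rw [lintegral_const_mul' _ _ ENNReal.ofReal_ne_top] at hmain
  refine hmain.trans (le_of_eq ?_)
  rw [hc, ENNReal.ofReal_mul (by positivity), ← ENNReal.ofReal_rpow_of_pos hV0,
    hV, ENNReal.ofReal_toReal hfin, gagliardo]

lemma gagliardo_eq_lintegral_prod {N : ℕ} {s : ℝ} {u : Euc N → ℝ} (hu : Measurable u) :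
    gagliardo N s u = ∫⁻ p : Euc N × Euc N,
      ENNReal.ofReal ((u p.1 - u p.2) ^ 2 / ‖p.1 - p.2‖ ^ ((N : ℝ) + 2 * s)) := by
  rw [gagliardo, Measure.volume_eq_prod, lintegral_prod _ (by fun_prop)]

lemma gagliardo_mono_of_sq_le {N : ℕ} {s : ℝ} {u φ : Euc N → ℝ}
    (h : ∀ x y, (φ x - φ y) ^ 2 ≤ (u x - u y) ^ 2) : gagliardo N s φ ≤ gagliardo N s u := by
  refine lintegral_mono fun x => lintegral_mono fun y => ENNReal.ofReal_le_ofReal ?_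
  exact div_le_div_of_nonneg_right (h x y) (by positivity)

lemma gagliardo_le_ofReal_dform {N : ℕ} {s : ℝ} {u φ : Euc N → ℝ}
    (hu : Measurable u) (hφ : Measurable φ) (hfin : gagliardo N s u ≠ ⊤)
    (h1 : ∀ x y, (φ x - φ y) ^ 2 ≤ (u x - u y) * (φ x - φ y))
    (h2 : ∀ x y, (u x - u y) * (φ x - φ y) ≤ (u x - u y) ^ 2) :
    gagliardo N s φ ≤ ENNReal.ofReal (dform N s u φ) := by
  have h0 : ∀ p : Euc N × Euc N, 0 ≤ (u p.1 - u p.2) * (φ p.1 - φ p.2) :=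
    fun p => (sq_nonneg _).trans (h1 _ _)
  have hint : Integrable (fun p : Euc N × Euc N =>
      (u p.1 - u p.2) * (φ p.1 - φ p.2) / ‖p.1 - p.2‖ ^ ((N : ℝ) + 2 * s)) := by
    refine ⟨Measurable.aestronglyMeasurable (by fun_prop), ?_⟩
    rw [hasFiniteIntegral_iff_ofReal
      (Eventually.of_forall fun p => div_nonneg (h0 p) (by positivity))]
    refine lt_of_le_of_lt (lintegral_mono fun p => ENNReal.ofReal_le_ofReal ?_)
      (gagliardo_eq_lintegral_prod hu ▸ hfin.lt_top)
    gcongr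
    exact h2 _ _
  rw [dform, ofReal_integral_eq_lintegral_ofReal hint
    (Eventually.of_forall fun p => div_nonneg (h0 p) (by positivity)),
    gagliardo_eq_lintegral_prod hφ]
  refine lintegral_mono fun p => ENNReal.ofReal_le_ofReal ?_
  gcongr
  exact h1 _ _

lemma truncation_diff {k h : ℝ} (hkh : k < h) (a b : ℝ) :
    (min (max (a - k) 0) (h - k) - min (max (b - k) 0) (h - k)) ^ 2 ≤
      (a - b) * (min (max (a - k) 0) (h - k) - min (max (b - k) 0) (h - k)) ∧
    (a - b) * (min (max (a - k) 0) (h - k) - min (max (b - k) 0) (h - k)) ≤ (a - b) ^ 2 := by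
  have hmono : ∀ a b : ℝ, b ≤ a →
      0 ≤ min (max (a - k) 0) (h - k) - min (max (b - k) 0) (h - k) ∧
      min (max (a - k) 0) (h - k) - min (max (b - k) 0) (h - k) ≤ a - b := by
    intro a b hab
    rcases le_total (a - k) 0 with h1 | h1 <;> rcases le_total (b - k) 0 with h2 | h2 <;>
    rcases le_total (a - k) (h - k) with h3 | h3 <;> rcases le_total (b - k) (h - k) with h4 | h4 <;>
    simp only [max_eq_left, max_eq_right, min_eq_left, min_eq_right, h1, h2, h3, h4,
      (sub_pos.2 hkh).le] <;> constructor <;> linarith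
  rcases le_total b a with hab | hab
  · obtain ⟨h1, h2⟩ := hmono a b hab
    constructor <;> nlinarith
  · obtain ⟨h1, h2⟩ := hmono b a hab
    constructor <;> nlinarith

lemma isEigenfunction.measure_superlevel_le {N : ℕ} {s q lam D : ℝ} {Ω : Set (Euc N)}
    {u : Euc N → ℝ} (hq : 1 < q) (hlam : 0 < lam)
    (hD : ∀ φ : Euc N → ℝ, Measurable φ → volume {x | φ x ≠ 0} ≠ ⊤ →
      ∫⁻ x, ENNReal.ofReal (φ x ^ 2) ≤
        ENNReal.ofReal D * volume {x | φ x ≠ 0} ^ (2 * s / N) * gagliardo N s φ)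
    (hu : isEigenfunction N s q Ω lam u)
    (hfin : ∫⁻ x, ENNReal.ofReal (u x) ^ q ≠ ⊤) {k h : ℝ} (hk : 0 < k) (hkh : k < h) :
    ENNReal.ofReal (h - k) * volume {x | h < u x} ≤
      ENNReal.ofReal D * ENNReal.ofReal (lam * (∫ x in Ω, |u x| ^ q) ^ ((2 - q) / q)) *
        volume {x | k < u x} ^ (2 * s / N) *
        ∫⁻ x in {x | k < u x}, ENNReal.ofReal (u x) ^ (q - 1) := by
  obtain ⟨⟨hum, hu0, hug⟩, hpos, heq⟩ := hu
  set φ : Euc N → ℝ := fun x => min (max (u x - k) 0) (h - k) with hφdef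
  have hφm : Measurable φ := by fun_prop
  have hhk : 0 < h - k := sub_pos.2 hkh
  have hφ0 : ∀ x, 0 ≤ φ x := fun x => le_min (le_max_right _ _) hhk.le
  have hφle : ∀ x, φ x ≤ h - k := fun x => min_le_right _ _
  have hsupp : {x | φ x ≠ 0} = {x | k < u x} := by
    ext x
    simp only [hφdef, Set.mem_ofPred_eq]
    rcases le_or_gt (u x) k with hx | hx
    · simp [hhk.le, hx]
    · have : 0 < min (max (u x - k) 0) (h - k) := lt_min (lt_max_of_lt_left (by linarith)) hhk
      simp [this.ne', hx]
  have hVfin : volume {x | k < u x} ≠ ⊤ := by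
    have hle : ENNReal.ofReal k ^ q * volume {x | k < u x} ≤ ∫⁻ x, ENNReal.ofReal (u x) ^ q := by
      rw [← setLIntegral_const]
      refine le_trans (setLIntegral_mono (by fun_prop) fun x hx => ?_)
        (setLIntegral_le_lintegral _ _)
      exact ENNReal.rpow_le_rpow (ENNReal.ofReal_le_ofReal (le_of_lt hx)) (by linarith)
    intro htop
    rw [htop, ENNReal.mul_top] at hle
    · exact hfin (top_le_iff.1 hle)
    · have : 0 < ENNReal.ofReal k := ENNReal.ofReal_pos.2 hk
      exact (ENNReal.rpow_pos this ENNReal.ofReal_ne_top).ne'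
  have hφK : memK N s Ω φ := by
    refine ⟨hφm, ?_, lt_of_le_of_lt (gagliardo_mono_of_sq_le fun x y => ?_) hug⟩
    · filter_upwards [hu0] with x hx hxΩ
      have : max (u x - k) 0 = 0 := max_eq_right (by rw [hx hxΩ]; linarith)
      simp [hφdef, this, hhk.le]
    · obtain ⟨h1, h2⟩ := truncation_diff hkh (u x) (u y)
      exact h1.trans h2
  have henergy : gagliardo N s φ ≤
      ENNReal.ofReal (lam * (∫ x in Ω, |u x| ^ q) ^ ((2 - q) / q)) *
        (ENNReal.ofReal (h - k) * ∫⁻ x in {x | k < u x}, ENNReal.ofReal (u x) ^ (q - 1)) := by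
    refine (gagliardo_le_ofReal_dform hum hφm hug.ne
      (fun x y => (truncation_diff hkh (u x) (u y)).1)
      (fun x y => (truncation_diff hkh (u x) (u y)).2)).trans ?_
    rw [heq φ hφK, ENNReal.ofReal_mul (by positivity)]
    gcongr
    have hnn : ∀ x, 0 ≤ |u x| ^ (q - 2) * u x * φ x := by
      intro x
      rcases le_or_gt (u x) k with hx | hx
      · have : φ x = 0 := by
          by_contra hne
          have : x ∈ {x | k < u x} := hsupp ▸ hne
          exact absurd this (not_lt.2 hx)
        simp [this]
      · have : 0 < u x := hk.trans hx
        have := hφ0 x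
        positivity
    rw [integral_eq_lintegral_of_nonneg_ae (Eventually.of_forall hnn)
      (Measurable.aestronglyMeasurable (by fun_prop))]
    refine ENNReal.ofReal_toReal_le.trans ((setLIntegral_le_lintegral _ _).trans ?_)
    rw [← lintegral_const_mul _ (by fun_prop), ← lintegral_indicator (measurableSet_lt measurable_const hum)]
    refine lintegral_mono fun x => ?_
    by_cases hx : k < u x
    · have hux : 0 < u x := hk.trans hx
      rw [Set.indicator_of_mem (by exact hx), ENNReal.ofReal_rpow_of_pos hux,
        ← ENNReal.ofReal_mul hhk.le]
      refine ENNReal.ofReal_le_ofReal ?_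
      rw [abs_of_pos hux, show q - 1 = (q - 2) + 1 by ring, Real.rpow_add hux, Real.rpow_one,
        mul_comm (h - k)]
      gcongr
      exact hφle x
    · have : φ x = 0 := by
        by_contra hne
        have : x ∈ {x | k < u x} := hsupp ▸ hne
        exact hx this
      simp [this]
  have hlow : ENNReal.ofReal (h - k) * (ENNReal.ofReal (h - k) * volume {x | h < u x}) ≤
      ∫⁻ x, ENNReal.ofReal (φ x ^ 2) := by
    rw [← mul_assoc, ← ENNReal.ofReal_mul hhk.le, ← setLIntegral_const]
    refine le_trans (setLIntegral_mono (by fun_prop) fun x hx => ?_)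
      (setLIntegral_le_lintegral _ _)
    have hx' : h < u x := hx
    have : φ x = h - k := min_eq_right (le_max_of_le_left (by linarith))
    rw [this, sq]
  have hFK := hD φ hφm (hsupp ▸ hVfin)
  rw [hsupp] at hFK
  have hc0 : ENNReal.ofReal (h - k) ≠ 0 := (ENNReal.ofReal_pos.2 hhk).ne'
  refine (ENNReal.mul_le_mul_iff_right hc0 ENNReal.ofReal_ne_top).1 ?_
  refine (hlow.trans hFK).trans ((mul_le_mul_right henergy _).trans (le_of_eq ?_))
  ring

lemma isEigenfunction.neg {N : ℕ} {s q lam : ℝ} {Ω : Set (Euc N)} {u : Euc N → ℝ}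
    (hu : isEigenfunction N s q Ω lam u) : isEigenfunction N s q Ω lam (fun x => -u x) := by
  obtain ⟨⟨hum, hu0, hug⟩, hpos, heq⟩ := hu
  refine ⟨⟨hum.neg, ?_, ?_⟩, by simpa using hpos, fun φ hφ => ?_⟩
  · filter_upwards [hu0] with x hx hxΩ
    simp [hx hxΩ]
  · refine lt_of_le_of_lt (gagliardo_mono_of_sq_le fun x y => le_of_eq ?_) hug
    ring
  · have h1 : dform N s (fun x => -u x) φ = -dform N s u φ := by
      rw [dform, dform, ← integral_neg]
      congr 1; ext p; ring
    have h2 : ∫ x in Ω, |-u x| ^ (q - 2) * -u x * φ x =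
        -∫ x in Ω, |u x| ^ (q - 2) * u x * φ x := by
      rw [← integral_neg]
      congr 1; ext x; rw [abs_neg]; ring
    rw [h1, h2, heq φ hφ]
    simp only [abs_neg]
    ring

lemma isEigenfunction.lintegral_ofReal_rpow_le {N : ℕ} {s q lam : ℝ} {Ω : Set (Euc N)}
    {u : Euc N → ℝ} (hq : 0 < q) (hΩ : MeasurableSet Ω) (hu : isEigenfunction N s q Ω lam u) :
    ∫⁻ x, ENNReal.ofReal (u x) ^ q ≤ ENNReal.ofReal (∫ x in Ω, |u x| ^ q) := by
  obtain ⟨⟨hum, hu0, hug⟩, hpos, heq⟩ := hu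
  have hint : Integrable (fun x => |u x| ^ q) (volume.restrict Ω) := by
    by_contra h
    rw [integral_undef h] at hpos
    exact hpos.false
  rw [ofReal_integral_eq_lintegral_ofReal hint (Eventually.of_forall fun x => by positivity),
    ← lintegral_indicator hΩ]
  refine lintegral_mono_ae ?_
  filter_upwards [hu0] with x hx
  by_cases hxΩ : x ∈ Ω
  · rw [Set.indicator_of_mem hxΩ, ← ENNReal.ofReal_rpow_of_nonneg (abs_nonneg _) hq.le]
    gcongr
    exact le_abs_self _
  · simp [hx hxΩ, hq]

lemma isEigenfunction.ae_le {N : ℕ} {s q lam D σ δ : ℝ} {Ω : Set (Euc N)} {u : Euc N → ℝ}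
    (hq : 1 < q) (hlam : 0 < lam) (hσ : 0 < σ) (hσs : σ = 2 * s / N) (hδ : 0 < δ)
    (hδq : δ = 2 - q + q * σ) (hD0 : 0 < D)
    (hD : ∀ φ : Euc N → ℝ, Measurable φ → volume {x | φ x ≠ 0} ≠ ⊤ →
      ∫⁻ x, ENNReal.ofReal (φ x ^ 2) ≤
        ENNReal.ofReal D * volume {x | φ x ≠ 0} ^ (2 * s / N) * gagliardo N s φ)
    (hΩ : MeasurableSet Ω) (hu : isEigenfunction N s q Ω lam u) :
    ∀ᵐ x, u x ≤ 2 * ((2 * 4 ^ q * (1 - 2 ^ (-δ))⁻¹ * D * 2 ^ (1 / σ) * lam) ^ (1 / δ) *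
      (∫ x in Ω, |u x| ^ q) ^ (1 / q)) := by
  have hum : Measurable u := hu.1.1
  have hI : 0 < ∫ x in Ω, |u x| ^ q := hu.2.1
  have hle := hu.lintegral_ofReal_rpow_le (by linarith) hΩ
  have hfin := ne_top_of_le_ne_top ENNReal.ofReal_ne_top hle
  have hlev := fun {k h : ℝ} => hu.measure_superlevel_le (k := k) (h := h) hq hlam hD hfin
  set I := ∫ x in Ω, |u x| ^ q
  have h2δ : (2 : ℝ) ^ (-δ) < 1 := Real.rpow_lt_one_of_one_lt_of_neg one_lt_two (by linarith)
  have hg : 0 < 1 - (2 : ℝ) ^ (-δ) := by linarith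
  set E : ℝ := 2 * 4 ^ q * (1 - 2 ^ (-δ))⁻¹ * D * 2 ^ (1 / σ) with hE
  have hE0 : 0 < E := by positivity
  set K : ℝ := (E * lam) ^ (1 / δ) * I ^ (1 / q) with hK
  have hK0 : 0 < K := by positivity
  have hKe : ENNReal.ofReal K ≠ 0 := (ENNReal.ofReal_pos.2 hK0).ne'
  set L : ℝ := lam * I ^ ((2 - q) / q) with hL
  have hL0 : 0 < L := by positivity
  have hlevset : ∀ t : ℝ, {x | t < u x / K} = {x | t * K < u x} := by
    intro t; ext x; exact lt_div_iff₀ hK0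
  have hscale : ∀ x, ∀ p : ℝ, 0 ≤ p → ENNReal.ofReal (u x) ^ p =
      ENNReal.ofReal (K ^ p) * ENNReal.ofReal (u x / K) ^ p := by
    intro x p hp
    rw [← ENNReal.ofReal_rpow_of_nonneg hK0.le hp, ← ENNReal.mul_rpow_of_nonneg _ _ hp,
      ← ENNReal.ofReal_mul hK0.le, mul_div_cancel₀ _ hK0.ne']
  have hG : ∫⁻ x, ENNReal.ofReal (u x / K) ^ q ≤ ENNReal.ofReal (K ^ (-q) * I) := by
    have h1 : ∀ x, ENNReal.ofReal (u x / K) ^ q =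
        ENNReal.ofReal (K ^ (-q)) * ENNReal.ofReal (u x) ^ q := by
      intro x
      rw [hscale x q (by linarith), ← mul_assoc, ← ENNReal.ofReal_mul (by positivity),
        ← Real.rpow_add hK0]
      simp
    simp only [h1]
    rw [lintegral_const_mul _ (by fun_prop), ENNReal.ofReal_mul (by positivity)]
    gcongr
  have hae := ae_le_two_of_superlevel_decay (μ := (volume : Measure (Euc N)))
    (v := fun x => u x / K) (A := ENNReal.ofReal (D * L * K ^ (q - 2))) (by fun_prop) hq hσ ?_
    (ne_top_of_le_ne_top ENNReal.ofReal_ne_top hG) ?_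
  · filter_upwards [hae] with x hx
    exact (div_le_iff₀ hK0).1 hx
  · intro k h hk hkh
    have h1 := hlev (k := k * K) (h := h * K) (by positivity) (by gcongr)
    rw [hlevset, hlevset]
    refine (ENNReal.mul_le_mul_iff_right hKe ENNReal.ofReal_ne_top).1 ?_
    rw [← mul_assoc, ← ENNReal.ofReal_mul hK0.le, show K * (h - k) = h * K - k * K by ring]
    refine h1.trans (le_of_eq ?_)
    simp only [hscale _ (q - 1) (by linarith)]
    rw [lintegral_const_mul _ (by fun_prop), ← hσs,
      show D * L * K ^ (q - 2) = D * (L * K ^ (q - 2)) by ring, ENNReal.ofReal_mul hD0.le,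
      ENNReal.ofReal_mul hL0.le, show q - 1 = 1 + (q - 2) by ring, Real.rpow_add hK0,
      Real.rpow_one, ENNReal.ofReal_mul hK0.le]
    ring
  · rw [← hδq]
    have h4 : (4 : ℝ≥0∞) ^ q = ENNReal.ofReal (4 ^ q) := by
      rw [← ENNReal.ofReal_rpow_of_pos (by norm_num)]; simp
    have h2 : ∀ p : ℝ, (2 : ℝ≥0∞) ^ p = ENNReal.ofReal (2 ^ p) := by
      intro p
      rw [← ENNReal.ofReal_rpow_of_pos (by norm_num)]; simp
    have hgi : (1 - (2 : ℝ≥0∞) ^ (-δ))⁻¹ = ENNReal.ofReal ((1 - 2 ^ (-δ))⁻¹) := by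
      rw [ENNReal.ofReal_inv_of_pos hg, ENNReal.ofReal_sub _ (by positivity), h2]; simp
    calc _ ≤ 2 * (4 ^ q * ENNReal.ofReal (D * L * K ^ (q - 2)) * (1 - 2 ^ (-δ))⁻¹) *
          ENNReal.ofReal (K ^ (-q) * I) ^ σ := by gcongr
      _ = ENNReal.ofReal (2 * (4 ^ q * (D * L * K ^ (q - 2)) * (1 - 2 ^ (-δ))⁻¹) *
          (K ^ (-q) * I) ^ σ) := by
        rw [hgi, h4, ENNReal.ofReal_rpow_of_nonneg (by positivity) hσ.le,
          ENNReal.ofReal_mul (p := 2 * _) (by positivity), ENNReal.ofReal_mul (p := 2) (by norm_num),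
          ENNReal.ofReal_mul (p := 4 ^ q * _) (by positivity),
          ENNReal.ofReal_mul (p := 4 ^ q) (by positivity)]
        simp
      _ = _ := by
        rw [h2]
        congr 1
        have hKδ : K ^ (q - 2) * K ^ (-q * σ) = (E * lam)⁻¹ * I ^ (-(δ / q)) := by
          rw [← Real.rpow_add hK0, show q - 2 + -q * σ = -δ by rw [hδq]; ring, hK,
            Real.mul_rpow (by positivity) (by positivity), ← Real.rpow_mul (by positivity),
            ← Real.rpow_mul hI.le, show 1 / δ * -δ = -1 by field_simp, Real.rpow_neg_one]
          congr 2; ring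
        have hIδ : I ^ ((2 - q) / q) * I ^ σ * I ^ (-(δ / q)) = 1 := by
          rw [← Real.rpow_add hI, ← Real.rpow_add hI,
            show (2 - q) / q + σ + -(δ / q) = 0 by rw [hδq]; field_simp; ring, Real.rpow_zero]
        rw [Real.mul_rpow (by positivity) hI.le, ← Real.rpow_mul hK0.le]
        calc _ = 2 * 4 ^ q * (1 - 2 ^ (-δ))⁻¹ * D * lam * (I ^ ((2 - q) / q) * I ^ σ) *
              (K ^ (q - 2) * K ^ (-q * σ)) := by rw [hL]; ring
          _ = 2 * 4 ^ q * (1 - 2 ^ (-δ))⁻¹ * D * lam * (E * lam)⁻¹ *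
              (I ^ ((2 - q) / q) * I ^ σ * I ^ (-(δ / q))) := by rw [hKδ]; ring
          _ = _ := by
            have hgne := hg.ne'
            generalize (1 : ℝ) - 2 ^ (-δ) = g at hE hgne
            rw [hIδ, hE, Real.rpow_neg zero_le_two]
            field_simp

/-- uniform `L^∞` bound on eigenfunctions when `N > 2s`. -/
theorem stmt_4 (N : ℕ) (hN : 1 ≤ N) (s : ℝ) (hs : s ∈ Set.Ioo (0 : ℝ) 1)
    (hNs : 2 * s < (N : ℝ))
    (q : ℝ) (hq1 : 1 < q) (hq2 : q < 2 * N / ((N : ℝ) - 2 * s)) :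
    ∃ C : ℝ, 0 < C ∧
      ∀ Ω : Set (Euc N), IsOpen Ω → compactEmbed N s q Ω →
        ∀ lam : ℝ, 0 < lam → ∀ u : Euc N → ℝ, isEigenfunction N s q Ω lam u →
          eLpNorm u ⊤ (volume.restrict Ω) ≤
            ENNReal.ofReal (C * lam ^ ((2 * N / ((N : ℝ) - 2 * s)) /
              (2 * (2 * N / ((N : ℝ) - 2 * s) - q))) * (∫ x in Ω, |u x| ^ q) ^ (1 / q)) := by
  obtain ⟨D, hD0, hD⟩ := lintegral_sq_le_gagliardo hN hs.1
  have hN0 : (0 : ℝ) < N := by exact_mod_cast hN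
  have hd : (0 : ℝ) < N - 2 * s := by linarith
  have hs0 := hs.1
  set σ : ℝ := 2 * s / N with hσ
  have hσ0 : 0 < σ := by positivity
  set δ : ℝ := 2 - q + q * σ with hδ
  have hδN : δ * N = 2 * N - q * (N - 2 * s) := by rw [hδ, hσ]; field_simp; ring
  have hnum : 0 < 2 * N - q * (N - 2 * s) := by
    have := (lt_div_iff₀ hd).1 hq2
    linarith
  have hδ0 : 0 < δ := by
    rw [← hδN] at hnum
    exact pos_of_mul_pos_left hnum hN0.le
  have hexp : (2 * N / ((N : ℝ) - 2 * s)) / (2 * (2 * N / ((N : ℝ) - 2 * s) - q)) = 1 / δ := by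
    rw [show 2 * N / ((N : ℝ) - 2 * s) - q = δ * N / (N - 2 * s) by rw [hδN]; field_simp]
    field_simp
  have hg : 0 < 1 - (2 : ℝ) ^ (-δ) :=
    sub_pos.2 (Real.rpow_lt_one_of_one_lt_of_neg one_lt_two (by linarith))
  set E : ℝ := 2 * 4 ^ q * (1 - 2 ^ (-δ))⁻¹ * D * 2 ^ (1 / σ) with hE
  have hE0 : 0 < E := by positivity
  refine ⟨2 * E ^ (1 / δ), by positivity, fun Ω hΩ _ lam hlam u hu => ?_⟩
  have h1 := hu.ae_le hq1 hlam hσ0 rfl hδ0 rfl hD0 hD hΩ.measurableSet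
  have h2 := hu.neg.ae_le hq1 hlam hσ0 rfl hδ0 rfl hD0 hD hΩ.measurableSet
  simp only [abs_neg] at h2
  rw [hexp, eLpNorm_exponent_top]
  refine eLpNormEssSup_le_of_ae_bound (ae_restrict_of_ae ?_)
  filter_upwards [h1, h2] with x hx1 hx2
  rw [← hE, Real.mul_rpow hE0.le hlam.le] at hx1 hx2
  rw [Real.norm_eq_abs, abs_le]
  constructor <;> linarith
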